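/- arXiv:2512.21088 — 2 statements merged into one kernel-verified Lean document; each statement's English description precedes it below -/
import Mathlib

section
/- Let N ≥ 2 be an integer. For every γ = [[a,b],[c,d]] ∈ Γ₀(N) and every τ in the complex upper half-plane, E₂^{(N)}((aτ+b)/(cτ+d)) = (cτ+d)² · E₂^{(N)}(τ); that is, E₂^{(N)} transforms as a modular form of weight 2 on Γ₀(N). -/
open Complex UpperHalfPlane Matrix MatrixGroups Filter

/-- `q = e^{2πiτ}`. -/
noncomputable def qExp (τ : ℂ) : ℂ := Complex.exp (2 * Real.pi * Complex.I * τ)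

/-- `σ_k(n) = Σ_{d ∣ n} d^k`. -/
def sigma' (k n : ℕ) : ℕ := ∑ d ∈ n.divisors, d ^ k

/-- Normalized Eisenstein series `E₄(τ) = 1 + 240 Σ_{n≥1} σ₃(n) qⁿ`. -/
noncomputable def E4 (τ : ℂ) : ℂ := 1 + 240 * ∑' n : ℕ+, (sigma' 3 n : ℂ) * qExp τ ^ (n : ℕ)

/-- Normalized Eisenstein series `E₆(τ) = 1 − 504 Σ_{n≥1} σ₅(n) qⁿ`. -/
noncomputable def E6 (τ : ℂ) : ℂ := 1 - 504 * ∑' n : ℕ+, (sigma' 5 n : ℂ) * qExp τ ^ (n : ℕ)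

/-- Normalized weight-2 Eisenstein series `E₂(τ) = 1 − 24 Σ_{n≥1} σ₁(n) qⁿ`. -/
noncomputable def E2 (τ : ℂ) : ℂ := 1 - 24 * ∑' n : ℕ+, (sigma' 1 n : ℂ) * qExp τ ^ (n : ℕ)

/-- `E₂^{(N)}(τ) = (N−1)/24 + Σ_{n≥1} σ₁(n)(qⁿ − N q^{Nn})`. -/
noncomputable def E2N (N : ℕ) (τ : ℂ) : ℂ :=
  ((N : ℂ) - 1) / 24 +
    ∑' n : ℕ+, (sigma' 1 n : ℂ) * (qExp τ ^ (n : ℕ) - (N : ℂ) * qExp τ ^ (N * (n : ℕ)))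

/-- `a₄(τ) = −E₄(τ)/(48 E₂^{(N)}(τ)²)`. -/
noncomputable def a4 (N : ℕ) (τ : ℂ) : ℂ := -E4 τ / (48 * E2N N τ ^ 2)

/-- `a₆(τ) = E₆(τ)/(864 E₂^{(N)}(τ)³)`. -/
noncomputable def a6 (N : ℕ) (τ : ℂ) : ℂ := E6 τ / (864 * E2N N τ ^ 3)

/-- `a₄′(τ) = −E₄(Nτ)/(48 E₂^{(N)}(τ)²)`. -/
noncomputable def a4' (N : ℕ) (τ : ℂ) : ℂ := -E4 ((N : ℂ) * τ) / (48 * E2N N τ ^ 2)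

/-- `a₆′(τ) = E₆(Nτ)/(864 E₂^{(N)}(τ)³)`. -/
noncomputable def a6' (N : ℕ) (τ : ℂ) : ℂ := E6 ((N : ℂ) * τ) / (864 * E2N N τ ^ 3)

lemma sigma'_one_eq (n : ℕ) : sigma' 1 n = ArithmeticFunction.sigma 1 n := by
  simp [sigma', ArithmeticFunction.sigma_apply]

lemma E2_eq_mathlib (z : ℍ) : E2 (z : ℂ) = EisensteinSeries.E2 z := by
  rw [EisensteinSeries.E2_eq_tsum_cexp]
  simp only [E2, sigma'_one_eq, qExp]

lemma summable_sigma_qExp (z : ℍ) :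
    Summable fun n : ℕ+ => (sigma' 1 n : ℂ) * qExp z ^ (n : ℕ) := by
  have h := (EisensteinSeries.summable_sigma_mul_cexp_pow (k := 2) one_le_two z)
  have h2 := h.comp_injective PNat.coe_injective
  simpa only [sigma'_one_eq, qExp, Function.comp_def] using h2

lemma E2_transform (γ : SL(2, ℤ)) (z : ℍ) :
    E2 (((γ 0 0 : ℤ) * (z : ℂ) + (γ 0 1 : ℤ)) / ((γ 1 0 : ℤ) * (z : ℂ) + (γ 1 1 : ℤ))) =
      ((γ 1 0 : ℤ) * (z : ℂ) + (γ 1 1 : ℤ)) ^ 2 * E2 z -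
      (1 / (2 * riemannZeta 2) * (2 * Real.pi * Complex.I)) * (γ 1 0 : ℤ) *
        ((γ 1 0 : ℤ) * (z : ℂ) + (γ 1 1 : ℤ)) := by
  have h := congrFun (EisensteinSeries.E2_slash_action γ) z
  have hd : (γ 1 0 : ℤ) * (z : ℂ) + (γ 1 1 : ℤ) ≠ 0 := by
    have := UpperHalfPlane.denom_ne_zero γ z
    rwa [ModularGroup.denom_apply] at this
  have hz : ((γ • z : ℍ) : ℂ) = ((γ 0 0 : ℤ) * (z : ℂ) + (γ 0 1 : ℤ)) / ((γ 1 0 : ℤ) * (z : ℂ) + (γ 1 1 : ℤ)) := by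
    rw [UpperHalfPlane.specialLinearGroup_apply]
    simp
  rw [← hz, E2_eq_mathlib, E2_eq_mathlib]
  rw [ModularForm.SL_slash_apply] at h
  simp only [EisensteinSeries.D2, Pi.sub_apply, Pi.smul_apply, smul_eq_mul,
    ModularGroup.denom_apply] at h
  set d := (γ 1 0 : ℤ) * (z : ℂ) + (γ 1 1 : ℤ)
  have h2 : EisensteinSeries.E2 (γ • z) = d ^ 2 * (EisensteinSeries.E2 (γ • z) * d ^ (-2 : ℤ)) := by
    rw [_root_.zpow_neg]; norm_cast; field_simp
  rw [h2, h]
  field_simp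

lemma E2N_eq (N : ℕ) (hN : 0 < N) (z : ℍ) :
    E2N N z = (N * E2 (N * z) - E2 z) / 24 := by
  have him : 0 < ((N : ℂ) * z).im := by
    simpa using mul_pos (Nat.cast_pos.mpr hN : (0 : ℝ) < N) z.im_pos
  have h1 := summable_sigma_qExp z
  have h2 := summable_sigma_qExp ⟨(N : ℂ) * z, him⟩
  have hq : ∀ n : ℕ, qExp (z : ℂ) ^ (N * n) = qExp ((N : ℂ) * z) ^ n := by
    intro n
    rw [pow_mul]
    congr 1
    simp only [qExp]
    rw [← Complex.exp_nat_mul]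
    ring_nf
  have h3 : ∑' n : ℕ+, (sigma' 1 n : ℂ) * (qExp z ^ (n : ℕ) - (N : ℂ) * qExp z ^ (N * (n : ℕ))) =
      (∑' n : ℕ+, (sigma' 1 n : ℂ) * qExp z ^ (n : ℕ)) -
        N * ∑' n : ℕ+, (sigma' 1 n : ℂ) * qExp (N * z) ^ (n : ℕ) := by
    rw [← tsum_mul_left, ← h1.tsum_sub (h2.mul_left (N : ℂ))]
    refine tsum_congr fun n => ?_
    rw [hq]
    simp only
    ring
  rw [E2N, h3, E2, E2]
  ring

/-- `E₂^{(N)}` transforms as a modular form of weight `2` on `Γ₀(N)`. -/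
theorem E2N_modular_weight_two (N : ℕ) (hN : 2 ≤ N)
    (γ : CongruenceSubgroup.Gamma0 N) (τ : ℍ) :
    E2N N (((((γ : SL(2, ℤ)) 0 0 : ℤ) : ℂ) * τ + (((γ : SL(2, ℤ)) 0 1 : ℤ) : ℂ)) /
           ((((γ : SL(2, ℤ)) 1 0 : ℤ) : ℂ) * τ + (((γ : SL(2, ℤ)) 1 1 : ℤ) : ℂ))) =
      ((((γ : SL(2, ℤ)) 1 0 : ℤ) : ℂ) * τ + (((γ : SL(2, ℤ)) 1 1 : ℤ) : ℂ)) ^ 2 *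
        E2N N (τ : ℂ) := by
  obtain ⟨g, hg⟩ := γ
  have hN0 : 0 < N := by omega
  have hNC : (N : ℂ) ≠ 0 := by exact_mod_cast hN0.ne'
  rw [CongruenceSubgroup.Gamma0_mem, ZMod.intCast_zmod_eq_zero_iff_dvd] at hg
  obtain ⟨c, hc⟩ := hg
  have hdet : g 0 0 * g 1 1 - g 0 1 * g 1 0 = 1 := by
    rw [← Matrix.det_fin_two]; exact g.2
  have him : 0 < ((N : ℂ) * τ).im := by
    simpa using mul_pos (Nat.cast_pos.mpr hN0 : (0 : ℝ) < N) τ.im_pos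
  let g' : SL(2, ℤ) := ⟨!![g 0 0, N * g 0 1; c, g 1 1], by
    rw [Matrix.det_fin_two_of]; rw [hc] at hdet; linarith⟩
  have t1 := E2_transform g τ
  have t2 := E2_transform g' ⟨(N : ℂ) * τ, him⟩
  have e00 : g' 0 0 = g 0 0 := rfl
  have e01 : g' 0 1 = N * g 0 1 := rfl
  have e10 : g' 1 0 = c := rfl
  have e11 : g' 1 1 = g 1 1 := rfl
  rw [e00, e01, e10, e11] at t2
  simp only at t2
  have hz : ((g • τ : ℍ) : ℂ) = ((g 0 0 : ℤ) * (τ : ℂ) + (g 0 1 : ℤ)) /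
      ((g 1 0 : ℤ) * (τ : ℂ) + (g 1 1 : ℤ)) := by
    rw [UpperHalfPlane.specialLinearGroup_apply]
    simp
  have hcC : ((g 1 0 : ℤ) : ℂ) = N * c := by rw [hc]; push_cast; ring
  have hden : (c : ℂ) * (N * τ) + (g 1 1 : ℤ) = (g 1 0 : ℤ) * (τ : ℂ) + (g 1 1 : ℤ) := by
    rw [hcC]; ring
  have hnum : ((g 0 0 : ℤ) : ℂ) * (N * τ) + ((N * g 0 1 : ℤ) : ℂ) =
      N * ((g 0 0 : ℤ) * (τ : ℂ) + (g 0 1 : ℤ)) := by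
    push_cast; ring
  rw [hden, hnum, mul_div_assoc, ← hz] at t2
  rw [← hz] at t1
  change E2N N (((g 0 0 : ℤ) * (τ : ℂ) + (g 0 1 : ℤ)) /
      ((g 1 0 : ℤ) * (τ : ℂ) + (g 1 1 : ℤ))) =
      ((g 1 0 : ℤ) * (τ : ℂ) + (g 1 1 : ℤ)) ^ 2 * E2N N τ
  rw [← hz, E2N_eq N hN0, E2N_eq N hN0, t1, t2]
  set d := ((g 1 0 : ℤ) : ℂ) * (τ : ℂ) + (g 1 1 : ℤ)
  rw [hcC]
  ring
end

section
/- For every τ in the complex upper half-plane, E₄(τ)³ − E₆(τ)² ≠ 0; in particular, E₄(τ) and E₆(τ) never vanish simultaneously. -/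
open Complex UpperHalfPlane Matrix MatrixGroups Filter

lemma qseries_aux (k : ℕ) (τ : ℍ) :
    ∑' n : ℕ+, (ArithmeticFunction.sigma k n : ℂ) * cexp (2 * Real.pi * Complex.I * τ) ^ (n : ℤ) =
      ∑' n : ℕ+, (sigma' k n : ℂ) * qExp τ ^ (n : ℕ) := by
  refine tsum_congr fun n => ?_
  rw [ArithmeticFunction.sigma_apply, sigma', qExp]
  norm_cast

lemma bernoulli_four_aux : bernoulli 4 = -1 / 30 := by
  rw [bernoulli_eq_bernoulli'_of_ne_one (by norm_num), bernoulli'_four]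

lemma bernoulli_six_aux : bernoulli 6 = 1 / 42 := by
  have h5 : bernoulli' 5 = 0 := bernoulli'_eq_zero_of_odd (by decide) (by norm_num)
  rw [bernoulli_eq_bernoulli'_of_ne_one (by norm_num), bernoulli'_def]
  norm_num [Finset.sum_range_succ, h5, Nat.choose]

lemma E4_eq_aux (τ : ℍ) : ModularForm.E₄ τ = E4 τ := by
  rw [EisensteinSeries.q_expansion_bernoulli _ (by decide), qseries_aux, bernoulli_four_aux, E4]
  push_cast
  ring

lemma E6_eq_aux (τ : ℍ) : ModularForm.E₆ τ = E6 τ := by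
  rw [EisensteinSeries.q_expansion_bernoulli _ (by decide), qseries_aux, bernoulli_six_aux, E6]
  push_cast
  ring

/-- The modular discriminant `E₄³ − E₆²` is nonvanishing on the upper half-plane. -/
theorem discriminant_ne_zero (τ : ℍ) : E4 (τ : ℂ) ^ 3 - E6 (τ : ℂ) ^ 2 ≠ 0 := by
  have h := ModularForm.discriminant_eq_E₄_cube_sub_E₆_sq τ
  rw [E4_eq_aux, E6_eq_aux] at h
  intro h0
  rw [h0, zero_div] at h
  exact ModularForm.discriminant_ne_zero τ h
end
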